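/- Under the bias identity and Fano argument, for any n ≤ k_*^{d(1−ε)} · e^{−(δ + H_b(ε))}, the plug-in estimator h(P̂_{S^n} ∗ φ_β) has worst-case bias at least δ over distributions supported in [−1,1]^d. -/

import Mathlib

open MeasureTheory Real

/-- The density of the Gaussian `N(μ, β²I_d)` on `ℝ^d`. -/
noncomputable def gaussPdf {d : ℕ} (β : ℝ) (μ t : EuclideanSpace ℝ (Fin d)) : ℝ :=
  (2 * π * β ^ 2) ^ (-(d : ℝ) / 2) * Real.exp (-‖t - μ‖ ^ 2 / (2 * β ^ 2))

/-- Differential entropy `h(g) = −∫ g log g` of a density on `ℝ^d`. -/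
noncomputable def diffEnt {d : ℕ} (g : EuclideanSpace ℝ (Fin d) → ℝ) : ℝ :=
  -∫ t, g t * Real.log (g t)

/-- The Gaussian tail function `Q(x) = (2π)^{-1/2} ∫_x^∞ e^{−t²/2} dt`. -/
noncomputable def Qfun (x : ℝ) : ℝ :=
  ∫ t in Set.Ioi x, (Real.sqrt (2 * π))⁻¹ * Real.exp (-t ^ 2 / 2)

/-- The binary entropy function. -/
noncomputable def binEnt (ε : ℝ) : ℝ := -(ε * Real.log ε + (1 - ε) * Real.log (1 - ε))

/-- The class `F_d` of probability distributions supported in `[−1,1]^d`. -/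
def cubeClass (d : ℕ) : Set (Measure (EuclideanSpace ℝ (Fin d))) :=
  {P | IsProbabilityMeasure P ∧ ∀ᵐ x ∂P, ∀ j, |x j| ≤ 1}

/-- Bias of the plug-in (sample propagation) estimator:
`h(P ∗ φ_β) − E[h(P̂_{S^n} ∗ φ_β)]` for `n` i.i.d. samples `S^n ~ P^{⊗n}`. -/
noncomputable def spBias (d n : ℕ) (β : ℝ) (P : Measure (EuclideanSpace ℝ (Fin d))) : ℝ :=
  diffEnt (fun t => ∫ s, gaussPdf β s t ∂P) -
    ∫ s : Fin n → EuclideanSpace ℝ (Fin d),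
      diffEnt (fun t => (n : ℝ)⁻¹ * ∑ i, gaussPdf β (s i) t) ∂(Measure.pi fun _ => P)


noncomputable def npdf (u : ℝ) : ℝ := (Real.sqrt (2 * π))⁻¹ * Real.exp (-u ^ 2 / 2)

lemma npdf_integrable : Integrable npdf := by
  have h := (integrable_exp_neg_mul_sq (b := 1/2) (by norm_num)).const_mul (Real.sqrt (2 * π))⁻¹
  refine h.congr (Filter.Eventually.of_forall fun u => ?_)
  simp only [npdf]
  congr 2; ring

lemma npdf_integral : ∫ u, npdf u = 1 := by
  have h := integral_gaussian (1/2)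
  have h2 : ∀ u, npdf u = (Real.sqrt (2 * π))⁻¹ * Real.exp (-(1/2) * u ^ 2) := by
    intro u; simp only [npdf]; congr 2; ring
  simp_rw [h2]
  rw [integral_const_mul, h]
  have : π / (1/2) = 2 * π := by ring
  rw [this]
  exact inv_mul_cancel₀ (by positivity)

lemma npdf_nonneg (u : ℝ) : 0 ≤ npdf u := by unfold npdf; positivity

lemma npdf_neg (u : ℝ) : npdf (-u) = npdf u := by simp [npdf]

lemma Qfun_eq (x : ℝ) : Qfun x = ∫ u in Set.Ioi x, npdf u := rfl

lemma Qfun_nonneg (x : ℝ) : 0 ≤ Qfun x := by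
  rw [Qfun_eq]; exact integral_nonneg npdf_nonneg

lemma Qfun_compl (x : ℝ) : (∫ u in Set.Iic x, npdf u) = 1 - Qfun x := by
  have := intervalIntegral.integral_Iic_add_Ioi (b := x) npdf_integrable.integrableOn
    npdf_integrable.integrableOn
  rw [npdf_integral] at this
  rw [Qfun_eq]; linarith

lemma Qfun_refl (x : ℝ) : (∫ u in Set.Iic (-x), npdf u) = Qfun x := by
  rw [Qfun_eq, ← integral_comp_neg_Ioi]
  simp [npdf_neg]

lemma Qfun_zero : Qfun 0 = 1 / 2 := by
  have h1 := Qfun_compl 0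
  have h2 := Qfun_refl 0
  rw [neg_zero] at h2
  linarith

lemma Qfun_box (x : ℝ) (hx : 0 < x) : (∫ u in Set.Ioc (-x) x, npdf u) = 1 - 2 * Qfun x := by
  have := intervalIntegral.integral_Iic_sub_Iic (a := -x) (b := x) (f := npdf) (μ := volume)
    npdf_integrable.integrableOn npdf_integrable.integrableOn
  rw [Qfun_compl, Qfun_refl, intervalIntegral.integral_of_le (by linarith)] at this
  linarith

lemma Qfun_le_half {x : ℝ} (hx : 0 < x) : Qfun x ≤ 1 / 2 := by
  have h := Qfun_box x hx
  have : 0 ≤ ∫ u in Set.Ioc (-x) x, npdf u := integral_nonneg npdf_nonneg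
  linarith

lemma Qfun_sub (x : ℝ) : Qfun x = 1/2 - ∫ u in (0:ℝ)..x, npdf u := by
  have := intervalIntegral.integral_Iic_sub_Iic (a := 0) (b := x) (f := npdf) (μ := volume)
    npdf_integrable.integrableOn npdf_integrable.integrableOn
  rw [Qfun_compl, Qfun_compl, Qfun_zero] at this
  linarith

lemma Qfun_continuous : Continuous Qfun := by
  have : Qfun = fun x => 1/2 - ∫ u in (0:ℝ)..x, npdf u := funext Qfun_sub
  rw [this]
  exact continuous_const.sub (intervalIntegral.continuous_primitive
    (fun a b => npdf_integrable.intervalIntegrable) 0)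

lemma Qfun_tendsto : Filter.Tendsto Qfun Filter.atTop (nhds 0) := by
  have : Qfun = fun x => 1/2 - ∫ u in (0:ℝ)..x, npdf u := funext Qfun_sub
  rw [this]
  have h := intervalIntegral_tendsto_integral_Ioi (f := npdf) (μ := volume) 0
    npdf_integrable.integrableOn Filter.tendsto_id
  have h2 : (∫ u in Set.Ioi (0:ℝ), npdf u) = 1/2 := Qfun_zero
  rw [h2] at h
  have h3 := h.const_sub (1/2)
  rw [sub_self] at h3
  exact h3

lemma Qfun_surj {q : ℝ} (h0 : 0 < q) (h1 : q < 1/2) : ∃ x, Qfun x = q := by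
  obtain ⟨b, hb⟩ := ((Qfun_tendsto.eventually (gt_mem_nhds h0)).and
    (Filter.eventually_ge_atTop 0)).exists
  have := intermediate_value_Icc' hb.2 Qfun_continuous.continuousOn
  obtain ⟨x, -, hx⟩ := this ⟨hb.1.le, by rw [Qfun_zero]; exact h1.le⟩
  exact ⟨x, hx⟩

/-! Gaussian density as a product -/

lemma gaussPdf_prod {d : ℕ} {β : ℝ} (hβ : 0 < β) (s t : EuclideanSpace ℝ (Fin d)) :
    gaussPdf β s t = ∏ j, β⁻¹ * npdf ((t j - s j) / β) := by
  have e1 : ∀ j, β⁻¹ * npdf ((t j - s j) / β) =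
      (2 * π * β ^ 2) ^ (-(1:ℝ) / 2) * Real.exp (-(t j - s j) ^ 2 / (2 * β ^ 2)) := by
    intro j
    unfold npdf
    have : (2 * π * β ^ 2) ^ (-(1:ℝ) / 2) = β⁻¹ * (Real.sqrt (2 * π))⁻¹ := by
      rw [neg_div, Real.rpow_neg (by positivity), ← Real.sqrt_eq_rpow,
        Real.sqrt_mul (by positivity), Real.sqrt_sq hβ.le, mul_inv, mul_comm]
    rw [this, mul_assoc]
    congr 3
    field_simp
  simp_rw [e1]
  rw [Finset.prod_mul_distrib, ← Real.exp_sum, Finset.prod_const, Finset.card_univ, Fintype.card_fin,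
    ← Real.rpow_mul_natCast (by positivity), gaussPdf]
  congr 2
  · ring
  · rw [EuclideanSpace.norm_sq_eq, ← Finset.sum_div]
    simp

lemma gaussPdf_box {d : ℕ} {β : ℝ} (hβ : 0 < β) (s : EuclideanSpace ℝ (Fin d)) (A : Set ℝ)
    (hA : MeasurableSet A) :
    ∫ t in {t : EuclideanSpace ℝ (Fin d) | ∀ j, (t j - s j) / β ∈ A}, gaussPdf β s t
      = (∫ u in A, npdf u) ^ d := by
  have hm : MeasurableSet {t : EuclideanSpace ℝ (Fin d) | ∀ j, (t j - s j) / β ∈ A} := by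
    rw [Set.ofPred_forall]
    refine MeasurableSet.iInter fun j => ?_
    have : Measurable fun t : EuclideanSpace ℝ (Fin d) => (t j - s j) / β := by fun_prop
    exact this hA
  rw [← integral_indicator hm]
  have e : ∀ t : EuclideanSpace ℝ (Fin d),
      Set.indicator {t : EuclideanSpace ℝ (Fin d) | ∀ j, (t j - s j) / β ∈ A}
        (fun t => gaussPdf β s t) t = ∏ j, β⁻¹ * (A.indicator npdf ((t j - s j) / β)) := by
    intro t
    by_cases h : ∀ j, (t j - s j) / β ∈ A
    · rw [Set.indicator_of_mem (by exact h), gaussPdf_prod hβ]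
      refine Finset.prod_congr rfl fun j _ => ?_
      rw [Set.indicator_of_mem (h j)]
    · rw [Set.indicator_of_notMem (by exact h)]
      push Not at h
      obtain ⟨j, hj⟩ := h
      rw [Finset.prod_eq_zero (Finset.mem_univ j)]
      rw [Set.indicator_of_notMem hj, mul_zero]
  rw [integral_congr_ae (Filter.Eventually.of_forall e)]
  rw [← (PiLp.volume_preserving_toLp (Fin d)).integral_comp
    (MeasurableEquiv.toLp 2 (Fin d → ℝ)).measurableEmbedding]
  have := integral_fintype_prod_volume_eq_prod (𝕜 := ℝ) (ι := Fin d) (E := fun _ => ℝ)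
    (fun j u => β⁻¹ * (A.indicator npdf ((u - s j) / β)))
  refine this.trans ?_
  have h1 : ∀ j, ∫ u : ℝ, β⁻¹ * (A.indicator npdf ((u - s j) / β)) = ∫ u in A, npdf u := by
    intro j
    rw [integral_const_mul, integral_sub_right_eq_self (fun u => A.indicator npdf (u / β)) (s j),
      Measure.integral_comp_div, integral_indicator hA, abs_of_pos hβ, smul_eq_mul,
      inv_mul_cancel_left₀ hβ.ne']
  simp [h1]

lemma gaussPdf_integral {d : ℕ} {β : ℝ} (hβ : 0 < β) (s : EuclideanSpace ℝ (Fin d)) :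
    ∫ t, gaussPdf β s t = 1 := by
  have := gaussPdf_box hβ s Set.univ MeasurableSet.univ
  simpa [npdf_integral] using this

/-! Uniform envelopes -/

noncomputable def gC (d : ℕ) (β : ℝ) : ℝ := (2 * π * β ^ 2) ^ (-(d : ℝ) / 2)

noncomputable def gEnv (d : ℕ) (β : ℝ) (t : EuclideanSpace ℝ (Fin d)) : ℝ :=
  gC d β * Real.exp (d / (2 * β ^ 2)) * Real.exp (-(1 / (4 * β ^ 2)) * ‖t‖ ^ 2)

noncomputable def gLow (d : ℕ) (β : ℝ) (t : EuclideanSpace ℝ (Fin d)) : ℝ :=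
  gC d β * Real.exp (-((‖t‖ ^ 2 + d) / β ^ 2))

noncomputable def gLog (d : ℕ) (β : ℝ) (t : EuclideanSpace ℝ (Fin d)) : ℝ :=
  |Real.log (gC d β)| + (‖t‖ ^ 2 + d) / β ^ 2

lemma gC_pos (d : ℕ) {β : ℝ} (hβ : 0 < β) : 0 < gC d β := by unfold gC; positivity

lemma gLow_pos {d : ℕ} {β : ℝ} (hβ : 0 < β) (t : EuclideanSpace ℝ (Fin d)) : 0 < gLow d β t :=
  mul_pos (gC_pos d hβ) (Real.exp_pos _)

lemma cube_norm {d : ℕ} {s : EuclideanSpace ℝ (Fin d)} (hs : ∀ j, |s j| ≤ 1) : ‖s‖ ^ 2 ≤ d := by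
  rw [EuclideanSpace.norm_sq_eq]
  calc ∑ i, ‖s i‖ ^ 2 ≤ ∑ i : Fin d, (1 : ℝ) := by
        refine Finset.sum_le_sum fun i _ => ?_
        have := hs i
        rw [Real.norm_eq_abs]
        have h0 := abs_nonneg (s i)
        nlinarith
    _ = d := by simp

lemma gaussPdf_le {d : ℕ} {β : ℝ} (hβ : 0 < β) (s t : EuclideanSpace ℝ (Fin d)) :
    gaussPdf β s t ≤ gC d β := by
  have h : Real.exp (-‖t - s‖ ^ 2 / (2 * β ^ 2)) ≤ 1 := by
    rw [Real.exp_le_one_iff, neg_div]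
    have : 0 ≤ ‖t - s‖ ^ 2 / (2 * β ^ 2) := by positivity
    linarith
  have := mul_le_mul_of_nonneg_left h (gC_pos d hβ).le
  rw [mul_one] at this
  exact this

lemma gaussPdf_pos {d : ℕ} {β : ℝ} (hβ : 0 < β) (s t : EuclideanSpace ℝ (Fin d)) :
    0 < gaussPdf β s t := mul_pos (gC_pos d hβ) (Real.exp_pos _)

lemma gaussPdf_env {d : ℕ} {β : ℝ} (hβ : 0 < β) (s t : EuclideanSpace ℝ (Fin d))
    (hs : ‖s‖ ^ 2 ≤ d) : gaussPdf β s t ≤ gEnv d β t := by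
  unfold gaussPdf gEnv
  rw [mul_assoc (gC d β), ← Real.exp_add]
  refine mul_le_mul_of_nonneg_left ?_ (gC_pos d hβ).le
  rw [Real.exp_le_exp]
  have h1 : ‖t‖ ≤ ‖t - s‖ + ‖s‖ := by simpa using norm_add_le (t - s) s
  have h2 : ‖t‖ ^ 2 ≤ 2 * ‖t - s‖ ^ 2 + 2 * d := by
    have h3 : ‖t‖ ^ 2 ≤ (‖t - s‖ + ‖s‖) ^ 2 := by gcongr
    nlinarith [sq_nonneg (‖t - s‖ - ‖s‖)]
  have e : (d : ℝ) / (2 * β ^ 2) + -(1 / (4 * β ^ 2)) * ‖t‖ ^ 2 - -‖t - s‖ ^ 2 / (2 * β ^ 2)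
    = (2 * ‖t - s‖ ^ 2 + 2 * d - ‖t‖ ^ 2) / (4 * β ^ 2) := by field_simp; ring
  have : 0 ≤ (2 * ‖t - s‖ ^ 2 + 2 * d - ‖t‖ ^ 2) / (4 * β ^ 2) :=
    div_nonneg (by linarith) (by positivity)
  linarith

lemma gaussPdf_low {d : ℕ} {β : ℝ} (hβ : 0 < β) (s t : EuclideanSpace ℝ (Fin d))
    (hs : ‖s‖ ^ 2 ≤ d) : gLow d β t ≤ gaussPdf β s t := by
  unfold gaussPdf gLow
  refine mul_le_mul_of_nonneg_left ?_ (gC_pos d hβ).le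
  rw [Real.exp_le_exp]
  have h1 : ‖t - s‖ ≤ ‖t‖ + ‖s‖ := norm_sub_le t s
  have h2 : ‖t - s‖ ^ 2 ≤ 2 * ‖t‖ ^ 2 + 2 * d := by
    have h3 : ‖t - s‖ ^ 2 ≤ (‖t‖ + ‖s‖) ^ 2 := by gcongr
    nlinarith [sq_nonneg (‖t‖ - ‖s‖)]
  have e : -‖t - s‖ ^ 2 / (2 * β ^ 2) - -((‖t‖ ^ 2 + d) / β ^ 2)
    = (2 * ‖t‖ ^ 2 + 2 * d - ‖t - s‖ ^ 2) / (2 * β ^ 2) := by field_simp; ring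
  have : 0 ≤ (2 * ‖t‖ ^ 2 + 2 * d - ‖t - s‖ ^ 2) / (2 * β ^ 2) :=
    div_nonneg (by linarith) (by positivity)
  linarith

lemma gaussPdf_measurable {d : ℕ} (β : ℝ) :
    Measurable fun p : EuclideanSpace ℝ (Fin d) × EuclideanSpace ℝ (Fin d) =>
      gaussPdf β p.1 p.2 := by
  unfold gaussPdf
  fun_prop

lemma gaussPdf_meas_right {d : ℕ} (β : ℝ) (s : EuclideanSpace ℝ (Fin d)) :
    Measurable (gaussPdf β s) := by
  unfold gaussPdf
  fun_prop

lemma gaussPdf_meas_left {d : ℕ} (β : ℝ) (t : EuclideanSpace ℝ (Fin d)) :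
    Measurable (fun s => gaussPdf β s t) := by
  unfold gaussPdf
  fun_prop

lemma gaussPdf_meas_pi {d n : ℕ} (β : ℝ) (i : Fin n) :
    Measurable fun p : (Fin n → EuclideanSpace ℝ (Fin d)) × EuclideanSpace ℝ (Fin d) =>
      gaussPdf β (p.1 i) p.2 := by
  unfold gaussPdf
  fun_prop

structure InEnv {d : ℕ} (β : ℝ) (g : EuclideanSpace ℝ (Fin d) → ℝ) : Prop where
  meas : Measurable g
  low : ∀ t, gLow d β t ≤ g t
  up : ∀ t, g t ≤ gC d β
  env : ∀ t, g t ≤ gEnv d β t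

lemma InEnv.pos {d : ℕ} {β : ℝ} (hβ : 0 < β) {g : EuclideanSpace ℝ (Fin d) → ℝ}
    (hg : InEnv β g) (t) : 0 < g t := (gLow_pos hβ t).trans_le (hg.low t)

lemma InEnv.gauss {d : ℕ} {β : ℝ} (hβ : 0 < β) (s : EuclideanSpace ℝ (Fin d))
    (hs : ∀ j, |s j| ≤ 1) : InEnv β (gaussPdf β s) where
  meas := gaussPdf_meas_right β s
  low t := gaussPdf_low hβ s t (cube_norm hs)
  up t := gaussPdf_le hβ s t
  env t := gaussPdf_env hβ s t (cube_norm hs)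

lemma InEnv.avg {d m : ℕ} {β : ℝ} {ι : Type*} [Fintype ι] (hm : Fintype.card ι = m) (h0 : 0 < m)
    {f : ι → EuclideanSpace ℝ (Fin d) → ℝ} (hf : ∀ i, InEnv β (f i)) :
    InEnv β (fun t => (m : ℝ)⁻¹ * ∑ i, f i t) := by
  have h0' : (0 : ℝ) < m := by exact_mod_cast h0
  have key : ∀ a : ℝ, a = (m : ℝ)⁻¹ * ∑ i : ι, a := by
    intro a; simp [hm]; field_simp
  refine ⟨?_, fun t => ?_, fun t => ?_, fun t => ?_⟩
  · exact (Finset.measurable_fun_sum _ fun i _ => (hf i).meas).const_mul _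
  · rw [key (gLow d β t)]
    gcongr with i; exact (hf i).low t
  · rw [key (gC d β)]
    gcongr with i; exact (hf i).up t
  · rw [key (gEnv d β t)]
    gcongr with i; exact (hf i).env t

lemma InEnv.mix {d : ℕ} {β : ℝ} (hβ : 0 < β) {P : Measure (EuclideanSpace ℝ (Fin d))}
    (hP : P ∈ cubeClass d) : InEnv β (fun t => ∫ s, gaussPdf β s t ∂P) := by
  obtain ⟨h1, h2⟩ := hP
  have hint : ∀ t, Integrable (fun s => gaussPdf β s t) P := by
    intro t
    refine Integrable.of_bound (C := gC d β)
      (gaussPdf_meas_left β t).aestronglyMeasurable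
      (Filter.Eventually.of_forall fun s => ?_)
    rw [Real.norm_eq_abs, abs_of_pos (gaussPdf_pos hβ s t)]
    exact gaussPdf_le hβ s t
  have key : ∀ a : ℝ, a = ∫ s, a ∂P := by intro a; simp
  refine ⟨?_, fun t => ?_, fun t => ?_, fun t => ?_⟩
  · have := (gaussPdf_measurable (d := d) β).stronglyMeasurable.integral_prod_left' (μ := P)
    exact this.measurable
  · rw [key (gLow d β t)]
    exact integral_mono_ae (integrable_const _) (hint t)
      (h2.mono fun s hs => (InEnv.gauss hβ s hs).low t)
  · rw [key (gC d β)]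
    exact integral_mono_ae (hint t) (integrable_const _)
      (h2.mono fun s hs => (InEnv.gauss hβ s hs).up t)
  · rw [key (gEnv d β t)]
    exact integral_mono_ae (hint t) (integrable_const _)
      (h2.mono fun s hs => (InEnv.gauss hβ s hs).env t)

lemma InEnv.log_le {d : ℕ} {β : ℝ} (hβ : 0 < β) {g : EuclideanSpace ℝ (Fin d) → ℝ}
    (hg : InEnv β g) (t) : |Real.log (g t)| ≤ gLog d β t := by
  have h1 := Real.log_le_log (hg.pos hβ t) (hg.up t)
  have h2 := Real.log_le_log (gLow_pos hβ t) (hg.low t)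
  unfold gLow at h2
  rw [Real.log_mul (gC_pos d hβ).ne' (Real.exp_pos _).ne', Real.log_exp] at h2
  have h3 := neg_abs_le (Real.log (gC d β))
  have h4 := le_abs_self (Real.log (gC d β))
  have h5 : 0 ≤ (‖t‖ ^ 2 + d) / β ^ 2 := by positivity
  unfold gLog
  rw [abs_le]
  constructor <;> linarith

lemma integrable_gauss_norm {d : ℕ} {b : ℝ} (hb : 0 < b) :
    Integrable fun t : EuclideanSpace ℝ (Fin d) => Real.exp (-b * ‖t‖ ^ 2) := by
  have h := (GaussianFourier.integrable_cexp_neg_mul_sq_norm_add (V := EuclideanSpace ℝ (Fin d))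
    (b := (b : ℂ)) (by simpa using hb) 0 0).norm
  refine h.congr (Filter.Eventually.of_forall fun t => ?_)
  simp only [Complex.norm_exp]
  congr 1
  have : (-(b : ℂ) * (‖t‖ : ℂ) ^ 2 + 0 * (inner ℝ (0 : EuclideanSpace ℝ (Fin d)) t : ℂ))
    = ((-b * ‖t‖ ^ 2 : ℝ) : ℂ) := by push_cast; ring
  rw [this, Complex.ofReal_re]

lemma gEnv_integrable {d : ℕ} {β : ℝ} (hβ : 0 < β) : Integrable (gEnv d β) :=
  (integrable_gauss_norm (by positivity)).const_mul _

lemma gLog_nonneg {d : ℕ} {β : ℝ} (t : EuclideanSpace ℝ (Fin d)) : 0 ≤ gLog d β t := by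
  unfold gLog; positivity

lemma gEnv_nonneg {d : ℕ} {β : ℝ} (hβ : 0 < β) (t : EuclideanSpace ℝ (Fin d)) :
    0 ≤ gEnv d β t := by
  have := gC_pos d hβ
  unfold gEnv; positivity

lemma gEnvLog_integrable {d : ℕ} {β : ℝ} (hβ : 0 < β) :
    Integrable fun t => gEnv d β t * gLog d β t := by
  have hC := gC_pos d hβ
  set D : ℝ := gC d β * Real.exp (d / (2 * β ^ 2)) with hD
  have hDp : 0 < D := by positivity
  set A : ℝ := |Real.log (gC d β)| + d / β ^ 2 with hA
  have hAp : 0 ≤ A := by positivity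
  have hI := (integrable_gauss_norm (d := d) (b := 1 / (8 * β ^ 2)) (by positivity)).const_mul
    (D * (A + 8))
  refine hI.mono' (by unfold gEnv gLog; fun_prop) (Filter.Eventually.of_forall fun t => ?_)
  rw [Real.norm_eq_abs, abs_of_nonneg (mul_nonneg (gEnv_nonneg hβ t) (gLog_nonneg t))]
  set y : ℝ := 1 / (8 * β ^ 2) * ‖t‖ ^ 2 with hy
  have hy0 : 0 ≤ y := by positivity
  have e1 : gEnv d β t = D * (Real.exp (-y) * Real.exp (-y)) := by
    unfold gEnv
    rw [← Real.exp_add, ← hD]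
    congr 2
    rw [hy]; field_simp; ring
  have e2 : gLog d β t = A + 8 * y := by
    unfold gLog
    rw [hA, hy]; field_simp; ring
  have e3 : -(1 / (8 * β ^ 2)) * ‖t‖ ^ 2 = -y := by rw [hy]; ring
  rw [e1, e2, e3]
  have h1 : Real.exp (-y) * (A + 8 * y) ≤ A + 8 := by
    have h2 : Real.exp (-y) ≤ 1 := by rw [Real.exp_le_one_iff]; linarith
    have h3 : Real.exp (-y) * y ≤ 1 := by
      rw [Real.exp_neg, inv_mul_le_iff₀ (Real.exp_pos y)]
      have := Real.add_one_le_exp y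
      linarith
    nlinarith
  calc D * (Real.exp (-y) * Real.exp (-y)) * (A + 8 * y)
      = D * Real.exp (-y) * (Real.exp (-y) * (A + 8 * y)) := by ring
    _ ≤ D * Real.exp (-y) * (A + 8) := by gcongr
    _ = D * (A + 8) * Real.exp (-y) := by ring

lemma InEnv.mul_log_le {d : ℕ} {β : ℝ} (hβ : 0 < β) {f g : EuclideanSpace ℝ (Fin d) → ℝ}
    (hf : InEnv β f) (hg : InEnv β g) (t) :
    ‖f t * Real.log (g t)‖ ≤ gEnv d β t * gLog d β t := by
  rw [norm_mul, Real.norm_eq_abs, Real.norm_eq_abs, abs_of_pos (hf.pos hβ t)]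
  exact mul_le_mul (hf.env t) (hg.log_le hβ t) (abs_nonneg _) (gEnv_nonneg hβ t)

lemma InEnv.integrable_mul_log {d : ℕ} {β : ℝ} (hβ : 0 < β) {f g : EuclideanSpace ℝ (Fin d) → ℝ}
    (hf : InEnv β f) (hg : InEnv β g) : Integrable fun t => f t * Real.log (g t) :=
  (gEnvLog_integrable hβ).mono' (hf.meas.mul hg.meas.log).aestronglyMeasurable
    (Filter.Eventually.of_forall (hf.mul_log_le hβ hg))

lemma InEnv.integrable {d : ℕ} {β : ℝ} (hβ : 0 < β) {f : EuclideanSpace ℝ (Fin d) → ℝ}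
    (hf : InEnv β f) : Integrable f :=
  (gEnv_integrable hβ).mono' hf.meas.aestronglyMeasurable
    (Filter.Eventually.of_forall fun t => by
      rw [Real.norm_eq_abs, abs_of_pos (hf.pos hβ t)]; exact hf.env t)

lemma InEnv.diffEnt_le {d : ℕ} {β : ℝ} (hβ : 0 < β) {g : EuclideanSpace ℝ (Fin d) → ℝ}
    (hg : InEnv β g) : |diffEnt g| ≤ ∫ t, gEnv d β t * gLog d β t := by
  unfold diffEnt
  rw [abs_neg, ← Real.norm_eq_abs]
  exact norm_integral_le_of_norm_le (gEnvLog_integrable hβ)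
    (Filter.Eventually.of_forall (hg.mul_log_le hβ hg))

lemma ae_cube {d n : ℕ} {P : Measure (EuclideanSpace ℝ (Fin d))} (hP : P ∈ cubeClass d) :
    ∀ᵐ s ∂(Measure.pi fun _ : Fin n => P), ∀ i j, |s i j| ≤ 1 := by
  obtain ⟨h1, h2⟩ := hP
  rw [ae_all_iff]
  intro i
  exact (Measure.quasiMeasurePreserving_eval (fun _ : Fin n => P) i).ae h2

lemma spBias_bdd {d n : ℕ} (hn : 0 < n) {β : ℝ} (hβ : 0 < β)
    {P : Measure (EuclideanSpace ℝ (Fin d))} (hP : P ∈ cubeClass d) :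
    |spBias d n β P| ≤ 2 * ∫ t, gEnv d β t * gLog d β t := by
  have h1 := (InEnv.mix hβ hP).diffEnt_le hβ
  have : IsProbabilityMeasure P := hP.1
  have h2 := norm_integral_le_of_norm_le_const (μ := Measure.pi fun _ : Fin n => P)
    (f := fun s => diffEnt (fun t => (n : ℝ)⁻¹ * ∑ i, gaussPdf β (s i) t))
    (C := ∫ t, gEnv d β t * gLog d β t) ((ae_cube hP).mono fun s hs =>
      (InEnv.avg (Fintype.card_fin n) hn fun i => InEnv.gauss hβ (s i) (hs i)).diffEnt_le hβ)
  simp only [probReal_univ, mul_one, Real.norm_eq_abs] at h2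
  unfold spBias
  refine (abs_sub _ _).trans ?_
  linarith

lemma emp_integrable {d n : ℕ} (hn : 0 < n) {β : ℝ} (hβ : 0 < β)
    {P : Measure (EuclideanSpace ℝ (Fin d))} (hP : P ∈ cubeClass d) :
    Integrable (fun s : Fin n → EuclideanSpace ℝ (Fin d) =>
      diffEnt (fun t => (n : ℝ)⁻¹ * ∑ i, gaussPdf β (s i) t)) (Measure.pi fun _ => P) := by
  have : IsProbabilityMeasure P := hP.1
  refine Integrable.of_bound (C := ∫ t, gEnv d β t * gLog d β t) ?_
    ((ae_cube hP).mono fun s hs =>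
      (InEnv.avg (Fintype.card_fin n) hn fun i => InEnv.gauss hβ (s i) (hs i)).diffEnt_le hβ)
  have hm : Measurable fun p : (Fin n → EuclideanSpace ℝ (Fin d)) × EuclideanSpace ℝ (Fin d) =>
      (n : ℝ)⁻¹ * ∑ i, gaussPdf β (p.1 i) p.2 := by
    refine (Finset.measurable_fun_sum _ fun i _ => ?_).const_mul _
    exact gaussPdf_meas_pi β i
  exact ((hm.mul hm.log).stronglyMeasurable.integral_prod_right'
    (ν := volume)).neg.aestronglyMeasurable

lemma ent_shift {d : ℕ} (β : ℝ) (s : EuclideanSpace ℝ (Fin d)) :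
    ∫ t, gaussPdf β s t * Real.log (gaussPdf β s t) =
      -diffEnt (gaussPdf β (0 : EuclideanSpace ℝ (Fin d))) := by
  have h : ∀ t, gaussPdf β s t = gaussPdf β 0 (t - s) := by intro t; simp [gaussPdf]
  simp_rw [h, diffEnt, neg_neg]
  exact integral_sub_right_eq_self
    (fun t => gaussPdf β (0 : EuclideanSpace ℝ (Fin d)) t * Real.log (gaussPdf β 0 t)) s

lemma avg_upper {d m : ℕ} {β H : ℝ} (hβ : 0 < β) {ι : Type*} [Fintype ι]
    (hm : Fintype.card ι = m) (h0 : 0 < m)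
    {f : ι → EuclideanSpace ℝ (Fin d) → ℝ} (hf : ∀ i, InEnv β (f i))
    (h1 : ∀ i, ∫ t, f i t = 1) (hH : ∀ i, ∫ t, f i t * Real.log (f i t) = -H) :
    diffEnt (fun t => (m : ℝ)⁻¹ * ∑ i, f i t) ≤ H + Real.log m := by
  have h0' : (0 : ℝ) < m := by exact_mod_cast h0
  have hg := InEnv.avg hm h0 hf
  have key : ∫ t, (m : ℝ)⁻¹ * ∑ i, (f i t * Real.log (f i t) - f i t * Real.log m) ≤
      ∫ t, ((m : ℝ)⁻¹ * ∑ i, f i t) * Real.log ((m : ℝ)⁻¹ * ∑ i, f i t) := by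
    refine integral_mono ?_ (hg.integrable_mul_log hβ hg) fun t => ?_
    · exact (integrable_finsetSum _ fun i _ => ((hf i).integrable_mul_log hβ (hf i)).sub
        (((hf i).integrable hβ).mul_const _)).const_mul _
    · simp only
      rw [mul_assoc, Finset.sum_mul]
      gcongr with i
      rw [← mul_sub]
      refine mul_le_mul_of_nonneg_left ?_ ((hf i).pos hβ t).le
      rw [← Real.log_div ((hf i).pos hβ t).ne' h0'.ne']
      refine Real.log_le_log (div_pos ((hf i).pos hβ t) h0') ?_
      rw [div_eq_inv_mul]
      gcongr
      exact Finset.single_le_sum (f := fun i => f i t) (fun j _ => ((hf j).pos hβ t).le)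
        (Finset.mem_univ i)
  have e : ∫ t, (m : ℝ)⁻¹ * ∑ i, (f i t * Real.log (f i t) - f i t * Real.log m) =
      -H - Real.log m := by
    have hi : ∀ i, Integrable fun t => f i t * Real.log (f i t) - f i t * Real.log m := fun i =>
      ((hf i).integrable_mul_log hβ (hf i)).sub (((hf i).integrable hβ).mul_const _)
    rw [integral_const_mul, integral_finsetSum _ fun i _ => hi i]
    have : ∀ i, ∫ t, (f i t * Real.log (f i t) - f i t * Real.log m) = -H - Real.log m := by
      intro i
      rw [integral_sub ((hf i).integrable_mul_log hβ (hf i)) (((hf i).integrable hβ).mul_const _),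
        hH, integral_mul_const, h1, one_mul]
    simp_rw [this]
    simp [hm]
    field_simp
  rw [e] at key
  unfold diffEnt
  linarith

lemma avg_lower {d m : ℕ} {β H p : ℝ} (hβ : 0 < β) {ι : Type*} [Fintype ι]
    (hm : Fintype.card ι = m) (h0 : 0 < m) (hp0 : 0 < p) (hp1 : p < 1)
    {f : ι → EuclideanSpace ℝ (Fin d) → ℝ} (hf : ∀ i, InEnv β (f i))
    (h1 : ∀ i, ∫ t, f i t = 1) (hH : ∀ i, ∫ t, f i t * Real.log (f i t) = -H)
    (B : ι → Set (EuclideanSpace ℝ (Fin d))) (hB : ∀ i, MeasurableSet (B i))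
    (hBd : ∀ t i j, t ∈ B i → t ∈ B j → i = j) (hBp : ∀ i, ∫ t in B i, f i t = p) :
    H + (p * Real.log m + p * Real.log p + (1 - p) * Real.log (1 - p)) ≤
      diffEnt (fun t => (m : ℝ)⁻¹ * ∑ i, f i t) := by
  classical
  have h0' : (0 : ℝ) < m := by exact_mod_cast h0
  have hg := InEnv.avg hm h0 hf
  set g : EuclideanSpace ℝ (Fin d) → ℝ := fun t => (m : ℝ)⁻¹ * ∑ i, f i t with hgdef
  set L : ℝ := Real.log (p * m) - Real.log (1 - p) with hL
  set F : ι → EuclideanSpace ℝ (Fin d) → ℝ := fun i t =>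
    f i t * Real.log (f i t) - (f i t * Real.log (1 - p) + L * (B i).indicator (f i) t) with hF
  have hi1 : ∀ i, Integrable fun t =>
      f i t * Real.log (1 - p) + L * (B i).indicator (f i) t := fun i =>
    (((hf i).integrable hβ).mul_const _).add
      ((((hf i).integrable hβ).indicator (hB i)).const_mul _)
  have hFi : ∀ i, Integrable (F i) := fun i =>
    ((hf i).integrable_mul_log hβ (hf i)).sub (hi1 i)
  have key : ∫ t, g t * Real.log (g t) ≤ ∫ t, (m : ℝ)⁻¹ * ∑ i, F i t := by
    refine integral_mono (hg.integrable_mul_log hβ hg)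
      ((integrable_finsetSum _ fun i _ => hFi i).const_mul _) fun t => ?_
    simp only
    have hgt := hg.pos hβ t
    have hsum : ∑ i, f i t = m * g t := by rw [hgdef]; field_simp
    have step : ∀ i, f i t * Real.log (g t) ≤ F i t +
        (((1 - p) + p * m * (if t ∈ B i then 1 else 0)) * g t - f i t) := by
      intro i
      have hft := (hf i).pos hβ t
      have gen : ∀ a : ℝ, 0 < a → f i t * Real.log (g t) ≤
          f i t * Real.log (f i t) - f i t * Real.log a + (a * g t - f i t) := by
        intro a ha
        have h := Real.log_le_sub_one_of_pos (show 0 < a * g t / f i t by positivity)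
        rw [Real.log_div (by positivity) hft.ne', Real.log_mul ha.ne' hgt.ne'] at h
        have h2 := mul_le_mul_of_nonneg_left h hft.le
        have h3 : f i t * (a * g t / f i t - 1) = a * g t - f i t := by field_simp
        rw [h3] at h2
        linarith
      by_cases ht : t ∈ B i
      · have h := gen (p * m) (by positivity)
        simp only [hF, hL, Set.indicator_of_mem ht, if_pos ht]
        have : 0 ≤ (1 - p) * g t := mul_nonneg (by linarith) hgt.le
        linarith
      · have h := gen (1 - p) (by linarith)
        simp only [hF, Set.indicator_of_notMem ht, if_neg ht]
        linarith
    have hcount : ∑ i, (if t ∈ B i then (1:ℝ) else 0) ≤ 1 := by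
      rw [Finset.sum_boole]
      have : (Finset.univ.filter fun i => t ∈ B i).card ≤ 1 := by
        rw [Finset.card_le_one]
        intro a ha b hb
        exact hBd t a b (Finset.mem_filter.mp ha).2 (Finset.mem_filter.mp hb).2
      exact_mod_cast this
    have tot := Finset.sum_le_sum fun i (_ : i ∈ Finset.univ) => step i
    have third : ∑ i, (((1 - p) + p * m * (if t ∈ B i then (1:ℝ) else 0)) * g t - f i t) =
        ((m : ℝ) * (1 - p) + p * m * ∑ i, (if t ∈ B i then (1:ℝ) else 0)) * g t - m * g t := by
      rw [Finset.sum_sub_distrib, hsum, ← Finset.sum_mul, Finset.sum_add_distrib,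
        ← Finset.mul_sum, Finset.sum_const, Finset.card_univ, hm, nsmul_eq_mul]
    rw [← Finset.sum_mul, hsum, Finset.sum_add_distrib, third] at tot
    have hle : ((m : ℝ) * (1 - p) + p * m * ∑ i, (if t ∈ B i then (1:ℝ) else 0)) * g t ≤ m * g t := by
      refine mul_le_mul_of_nonneg_right ?_ hgt.le
      have := mul_le_mul_of_nonneg_left hcount (show 0 ≤ p * m by positivity)
      linarith
    rw [le_inv_mul_iff₀ h0']
    linarith
  have e : ∫ t, (m : ℝ)⁻¹ * ∑ i, F i t = -H - (Real.log (1 - p) + L * p) := by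
    rw [integral_const_mul, integral_finsetSum _ fun i _ => hFi i]
    have : ∀ i, ∫ t, F i t = -H - (Real.log (1 - p) + L * p) := by
      intro i
      rw [hF]
      simp only
      rw [integral_sub ((hf i).integrable_mul_log hβ (hf i)) (hi1 i), hH,
        integral_add (((hf i).integrable hβ).mul_const _)
          ((((hf i).integrable hβ).indicator (hB i)).const_mul _),
        integral_mul_const, h1, one_mul, integral_const_mul, integral_indicator (hB i), hBp]
    simp_rw [this]
    simp [hm]
    field_simp
  rw [e, hL, Real.log_mul hp0.ne' h0'.ne'] at key
  unfold diffEnt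
  linarith

/-- The lattice points. -/
noncomputable def latPt {d k : ℕ} (c : Fin d → Fin k) : EuclideanSpace ℝ (Fin d) :=
  WithLp.toLp 2 fun j => -1 + (2 * ((c j : ℕ) : ℝ) + 1) / k

lemma latPt_cube {d k : ℕ} (c : Fin d → Fin k) (j : Fin d) : |latPt c j| ≤ 1 := by
  have h1 : ((c j : ℕ) : ℝ) + 1 ≤ k := by exact_mod_cast (c j).2
  have h2 : (0 : ℝ) ≤ ((c j : ℕ) : ℝ) := by positivity
  have hk : (0 : ℝ) < k := by linarith
  have h3 : (2 * ((c j : ℕ) : ℝ) + 1) / k ≤ 2 := by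
    rw [div_le_iff₀ hk]; linarith
  have h4 : 0 ≤ (2 * ((c j : ℕ) : ℝ) + 1) / k := by positivity
  simp only [latPt]
  rw [abs_le]; constructor <;> linarith

lemma lat_disj {d k : ℕ} {β x : ℝ} (hβ : 0 < β) (hkx : (k : ℝ) * (β * x) ≤ 1)
    (t : EuclideanSpace ℝ (Fin d)) (c c' : Fin d → Fin k)
    (h : ∀ j, (t j - latPt c j) / β ∈ Set.Ioc (-x) x)
    (h' : ∀ j, (t j - latPt c' j) / β ∈ Set.Ioc (-x) x) : c = c' := by
  funext j
  have hk : (0 : ℝ) < k := by exact_mod_cast (Nat.zero_le _).trans_lt (c j).2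
  obtain ⟨a1, a2⟩ := h j
  obtain ⟨b1, b2⟩ := h' j
  rw [lt_div_iff₀ hβ] at a1 b1
  rw [div_le_iff₀ hβ] at a2 b2
  simp only [latPt] at a1 a2 b1 b2
  have e : ∀ u : ℝ, (k : ℝ) * (-1 + (2 * u + 1) / k) = -k + 2 * u + 1 := by
    intro u; field_simp; ring
  have m1 := mul_lt_mul_of_pos_left a1 hk
  have m2 := mul_le_mul_of_nonneg_left a2 hk.le
  have m3 := mul_lt_mul_of_pos_left b1 hk
  have m4 := mul_le_mul_of_nonneg_left b2 hk.le
  rw [mul_sub, e] at m1 m2 m3 m4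
  have r1 : ((c j : ℕ) : ℝ) < ((c' j : ℕ) : ℝ) + 1 := by nlinarith
  have r2 : ((c' j : ℕ) : ℝ) < ((c j : ℕ) : ℝ) + 1 := by nlinarith
  have r1' : (c j : ℕ) < (c' j : ℕ) + 1 := by exact_mod_cast r1
  have r2' : (c' j : ℕ) < (c j : ℕ) + 1 := by exact_mod_cast r2
  apply Fin.ext
  omega

lemma spBias_lattice {d n k : ℕ} (hn : 0 < n) (hk : 0 < k) {β x p : ℝ} (hβ : 0 < β) (hx : 0 < x)
    (hkx : (k : ℝ) * (β * x) ≤ 1) (hp0 : 0 < p) (hp1 : p < 1) (hp : (1 - 2 * Qfun x) ^ d = p) :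
    ∃ P ∈ cubeClass d, p * Real.log ((k ^ d : ℕ) : ℝ) + p * Real.log p
      + (1 - p) * Real.log (1 - p) - Real.log n ≤ spBias d n β P := by
  have hcard : Fintype.card (Fin d → Fin k) = k ^ d := by simp
  have hK : 0 < k ^ d := by positivity
  have hK' : ((k ^ d : ℕ) : ENNReal) ≠ 0 := by exact_mod_cast hK.ne'
  let P : Measure (EuclideanSpace ℝ (Fin d)) :=
    ((k ^ d : ℕ) : ENNReal)⁻¹ • ∑ c : Fin d → Fin k, Measure.dirac (latPt c)
  have hPc : P ∈ cubeClass d := by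
    refine ⟨⟨?_⟩, ?_⟩
    · simp only [P, Measure.smul_apply, Measure.finsetSum_apply, measure_univ, Finset.sum_const,
        Finset.card_univ, hcard, nsmul_eq_mul, mul_one, smul_eq_mul]
      exact ENNReal.inv_mul_cancel hK' (ENNReal.natCast_ne_top _)
    · refine Measure.ae_smul_measure ?_ _
      rw [ae_iff, Measure.finsetSum_apply]
      refine Finset.sum_eq_zero fun c _ => ?_
      rw [← ae_iff]
      have hms : MeasurableSet {x : EuclideanSpace ℝ (Fin d) | ∀ j, |x j| ≤ 1} := by
        rw [Set.ofPred_forall]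
        refine MeasurableSet.iInter fun j => ?_
        exact measurableSet_le (by fun_prop) measurable_const
      rw [ae_dirac_iff hms]
      exact latPt_cube c
  refine ⟨P, hPc, ?_⟩
  have : IsProbabilityMeasure P := hPc.1
  have hmix : (fun t => ∫ s, gaussPdf β s t ∂P) =
      fun t => ((k ^ d : ℕ) : ℝ)⁻¹ * ∑ c : Fin d → Fin k, gaussPdf β (latPt c) t := by
    funext t
    simp only [P]
    rw [integral_smul_measure, integral_finsetSum_measure fun c _ => integrable_dirac (by simp)]
    simp [integral_dirac]
  set H := diffEnt (gaussPdf β (0 : EuclideanSpace ℝ (Fin d))) with hH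
  have hlow := avg_lower hβ hcard hK hp0 hp1 (H := H)
    (f := fun c : Fin d → Fin k => gaussPdf β (latPt c))
    (fun c => InEnv.gauss hβ _ (latPt_cube c)) (fun c => gaussPdf_integral hβ _)
    (fun c => ent_shift β _)
    (fun c => {t | ∀ j, (t j - latPt c j) / β ∈ Set.Ioc (-x) x})
    (fun c => by
      rw [Set.ofPred_forall]
      refine MeasurableSet.iInter fun j => ?_
      have : Measurable fun t : EuclideanSpace ℝ (Fin d) => (t j - latPt c j) / β := by fun_prop
      exact this measurableSet_Ioc)
    (fun t c c' h h' => lat_disj hβ hkx t c c' h h')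
    (fun c => by rw [gaussPdf_box hβ _ _ measurableSet_Ioc, Qfun_box x hx, hp])
  have hup : ∫ s : Fin n → EuclideanSpace ℝ (Fin d),
      diffEnt (fun t => (n : ℝ)⁻¹ * ∑ i, gaussPdf β (s i) t) ∂(Measure.pi fun _ => P)
        ≤ H + Real.log n := by
    have := integral_mono_ae (emp_integrable hn hβ hPc) (integrable_const (H + Real.log n))
      ((ae_cube hPc).mono fun s hs => avg_upper hβ (Fintype.card_fin n) hn (H := H)
        (f := fun i => gaussPdf β (s i))
        (fun i => InEnv.gauss hβ _ (hs i)) (fun i => gaussPdf_integral hβ _)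
        (fun i => ent_shift β _))
    simpa using this
  unfold spBias
  rw [hmix]
  linarith

/-- Sample-complexity consequence of the bias lower bound: if
`n ≤ k_*^{d(1−ε)} e^{−(δ + H_b(ε))}`, then the worst-case bias of the plug-in estimator over
distributions supported in `[−1,1]^d` is at least `δ`. -/
theorem spBias_ge_of_small_n (d n : ℕ) (hd : 1 ≤ d) (hn : 0 < n) (β ε δ : ℝ) (hβ : 0 < β)
    (hε₁ : 1 - (1 - 2 * Qfun (1 / (2 * β))) ^ d < ε) (hε₂ : ε ≤ 1) (hδ : 0 < δ)
    (kstar : ℕ)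
    (hk : kstar = ⌊1 / (β * Function.invFun Qfun ((1 - (1 - ε) ^ ((1 : ℝ) / d)) / 2))⌋₊)
    (hsmall : (n : ℝ) ≤ (kstar : ℝ) ^ ((d : ℝ) * (1 - ε)) * Real.exp (-(δ + binEnt ε))) :
    (⨆ P : cubeClass d, |spBias d n β P|) ≥ δ := by

  have hb : 0 < 1 / (2 * β) := by positivity
  have hq0 := Qfun_nonneg (1 / (2 * β))
  have hq1 := Qfun_le_half hb
  have hε0 : 0 < ε := by
    have : (1 - 2 * Qfun (1 / (2 * β))) ^ d ≤ 1 := pow_le_one₀ (by linarith) (by linarith)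
    linarith
  have hn1 : (1 : ℝ) ≤ n := by exact_mod_cast hn
  have hd' : (0 : ℝ) < d := by exact_mod_cast hd
  have hε1 : ε < 1 := by
    refine lt_of_le_of_ne hε₂ fun h => ?_
    subst h
    simp only [sub_self, mul_zero, Real.rpow_zero, one_mul, binEnt, Real.log_one, add_zero,
      zero_mul, neg_zero] at hsmall
    have : Real.exp (-δ) < 1 := by rw [Real.exp_lt_one_iff]; linarith
    linarith
  have hk0 : 0 < kstar := by
    rcases Nat.eq_zero_or_pos kstar with h | h
    · rw [h, Nat.cast_zero, Real.zero_rpow (by have := sub_pos.mpr hε1; positivity), zero_mul]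
        at hsmall
      linarith
    · exact h
  set r : ℝ := (1 - ε) ^ ((1 : ℝ) / d) with hr
  have hr0 : 0 < r := Real.rpow_pos_of_pos (by linarith) _
  have hr1 : r < 1 := Real.rpow_lt_one (by linarith) (by linarith) (by positivity)
  have hrd : r ^ d = 1 - ε := by
    rw [hr, ← Real.rpow_mul_natCast (by linarith), one_div, inv_mul_cancel₀ hd'.ne', Real.rpow_one]
  have hQ : Qfun (Function.invFun Qfun ((1 - r) / 2)) = (1 - r) / 2 :=
    Function.invFun_eq (Qfun_surj (by linarith) (by linarith))
  set x := Function.invFun Qfun ((1 - r) / 2) with hx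
  have hfl : 1 ≤ ⌊1 / (β * x)⌋₊ := by rw [← hk]; exact hk0
  have hpos : (1 : ℝ) ≤ 1 / (β * x) := by
    have := (Nat.one_le_floor_iff _).mp hfl
    exact this
  have hβx : 0 < β * x := by
    have : 0 < 1 / (β * x) := by linarith
    exact one_div_pos.mp this
  have hx0 : 0 < x := pos_of_mul_pos_right hβx hβ.le
  have hkx : (kstar : ℝ) * (β * x) ≤ 1 := by
    have := Nat.floor_le (show 0 ≤ 1 / (β * x) by linarith)
    rw [← hk, le_div_iff₀ hβx] at this
    exact this
  obtain ⟨P, hP, hbias⟩ := spBias_lattice (d := d) (p := 1 - ε) hn hk0 hβ hx0 hkx (by linarith)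
    (by linarith) (by rw [hQ, ← hrd]; congr 1; ring)
  have hlog : Real.log n ≤ d * (1 - ε) * Real.log kstar - (δ + binEnt ε) := by
    have hk0' : (0 : ℝ) < kstar := by exact_mod_cast hk0
    have := Real.log_le_log (by linarith) hsmall
    rw [Real.log_mul (Real.rpow_pos_of_pos hk0' _).ne' (Real.exp_pos _).ne', Real.log_exp,
      Real.log_rpow hk0'] at this
    linarith
  have hfin : δ ≤ spBias d n β P := by
    refine le_trans ?_ hbias
    push_cast
    rw [Real.log_pow, sub_sub_cancel]
    unfold binEnt at hlog
    linarith
  have hbdd : BddAbove (Set.range fun P : cubeClass d => |spBias d n β P|) := by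
    refine ⟨2 * ∫ t, gEnv d β t * gLog d β t, ?_⟩
    rintro _ ⟨P, rfl⟩
    exact spBias_bdd hn hβ P.2
  exact (hfin.trans (le_abs_self _)).trans (le_ciSup hbdd ⟨P, hP⟩)
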